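/- arXiv:2012.11561 — 2 statements merged into one kernel-verified Lean document; each statement's English description precedes it below -/
import Mathlib

section
/- For every ε > 0 and every integer k with |k| ≥ 1, the eigenvalues of the slender body integral operator for a straight periodic fiber are strictly negative: λᶻ_k := −(1/(8π))·((4 + π²ε²k²)·K₀(πε|k|) − 2πε|k|·K₁(πε|k|)) < 0 (tangential direction) and λˣ_k := −(1/(8π))·(2K₀(πε|k|) + πε|k|·K₁(πε|k|)) < 0 (normal directions). -/
/-- Modified Bessel function of the second kind, order 0. -/
noncomputable def K0 (x : ℝ) : ℝ := ∫ t in Set.Ioi (0:ℝ), Real.exp (-x * Real.cosh t)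

/-- Modified Bessel function of the second kind, order 1. -/
noncomputable def K1 (x : ℝ) : ℝ := ∫ t in Set.Ioi (0:ℝ), Real.exp (-x * Real.cosh t) * Real.cosh t

open MeasureTheory Filter Topology Set

lemma exp_neg_mul_cosh_mul_cosh_le {x : ℝ} (hx : 0 < x) (t : ℝ) :
    Real.exp (-x * Real.cosh t) * Real.cosh t ≤ 4 / x ^ 2 * Real.exp (-t) := by
  have hc : 0 < Real.cosh t := Real.cosh_pos t
  have hquad := Real.quadratic_le_exp_of_nonneg (mul_pos hx hc).le
  have hexp : Real.exp (-x * Real.cosh t) * Real.exp (x * Real.cosh t) = 1 := by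
    rw [← Real.exp_add]; simp
  have hbound : Real.exp (-x * Real.cosh t) * (x * Real.cosh t) ^ 2 ≤ 2 := by
    have := mul_le_mul_of_nonneg_left hquad (Real.exp_pos (-x * Real.cosh t)).le
    nlinarith [mul_pos (Real.exp_pos (-x * Real.cosh t)) (mul_pos hx hc),
      Real.exp_pos (-x * Real.cosh t)]
  have hcosh : Real.exp t ≤ 2 * Real.cosh t := by
    rw [Real.cosh_eq]; linarith [Real.exp_pos (-t)]
  rw [Real.exp_neg, ← div_eq_mul_inv, div_div, le_div_iff₀ (by positivity)]
  calc Real.exp (-x * Real.cosh t) * Real.cosh t * (x ^ 2 * Real.exp t)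
      ≤ Real.exp (-x * Real.cosh t) * Real.cosh t * (x ^ 2 * (2 * Real.cosh t)) := by gcongr
    _ = 2 * (Real.exp (-x * Real.cosh t) * (x * Real.cosh t) ^ 2) := by ring
    _ ≤ 4 := by linarith

lemma integrableOn_exp_neg_mul_cosh_mul_cosh {x : ℝ} (hx : 0 < x) :
    IntegrableOn (fun t => Real.exp (-x * Real.cosh t) * Real.cosh t) (Ioi 0) := by
  refine ((integrableOn_exp_neg_Ioi 0).const_mul (4 / x ^ 2)).mono'
    (Continuous.aestronglyMeasurable (by fun_prop)) (ae_of_all _ fun t => ?_)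
  have hc : 0 < Real.cosh t := Real.cosh_pos t
  rw [Real.norm_of_nonneg (by positivity)]
  exact exp_neg_mul_cosh_mul_cosh_le hx t

lemma exp_neg_mul_cosh_le_mul_cosh (x t : ℝ) :
    Real.exp (-x * Real.cosh t) ≤ Real.exp (-x * Real.cosh t) * Real.cosh t :=
  le_mul_of_one_le_right (Real.exp_pos _).le (Real.one_le_cosh t)

lemma integrableOn_exp_neg_mul_cosh {x : ℝ} (hx : 0 < x) :
    IntegrableOn (fun t => Real.exp (-x * Real.cosh t)) (Ioi 0) := by
  refine (integrableOn_exp_neg_mul_cosh_mul_cosh hx).mono'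
    (Continuous.aestronglyMeasurable (by fun_prop)) (ae_of_all _ fun t => ?_)
  rw [Real.norm_of_nonneg (Real.exp_pos _).le]
  exact exp_neg_mul_cosh_le_mul_cosh x t

lemma K0_pos {x : ℝ} (hx : 0 < x) : 0 < K0 x := by
  have : NeZero (volume.restrict (Ioi (0 : ℝ))) := ⟨by simp [Measure.restrict_eq_zero]⟩
  exact integral_exp_pos (integrableOn_exp_neg_mul_cosh hx)

lemma K0_le_K1 {x : ℝ} (hx : 0 < x) : K0 x ≤ K1 x :=
  integral_mono (integrableOn_exp_neg_mul_cosh hx) (integrableOn_exp_neg_mul_cosh_mul_cosh hx)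
    (exp_neg_mul_cosh_le_mul_cosh x)

lemma hasDerivAt_exp_neg_mul_cosh_mul_tanh_half (x t : ℝ) :
    HasDerivAt (fun t => Real.exp (-x * Real.cosh t) * (Real.sinh t / (1 + Real.cosh t)))
      (Real.exp (-x * Real.cosh t) * (1 / (1 + Real.cosh t))
        - x * (Real.exp (-x * Real.cosh t) * Real.cosh t - Real.exp (-x * Real.cosh t))) t := by
  have hc : 1 + Real.cosh t ≠ 0 := by linarith [Real.cosh_pos t]
  have h := (((Real.hasDerivAt_cosh t).const_mul (-x)).exp).mul
    ((Real.hasDerivAt_sinh t).div ((Real.hasDerivAt_cosh t).const_add 1) hc)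
  refine h.congr_deriv ?_
  simp only [Pi.div_apply]
  have hs : Real.sinh t ^ 2 = Real.cosh t ^ 2 - 1 := Real.sinh_sq t
  field_simp
  linear_combination (-x * (1 + Real.cosh t) - 1) * hs

lemma tendsto_exp_neg_mul_cosh_mul_tanh_half {x : ℝ} (hx : 0 < x) :
    Tendsto (fun t => Real.exp (-x * Real.cosh t) * (Real.sinh t / (1 + Real.cosh t)))
      atTop (𝓝 0) := by
  have hlim : Tendsto (fun t : ℝ => 4 / x ^ 2 * Real.exp (-t)) atTop (𝓝 0) := by
    simpa using Real.tendsto_exp_neg_atTop_nhds_zero.const_mul (4 / x ^ 2)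
  refine tendsto_of_tendsto_of_tendsto_of_le_of_le' tendsto_const_nhds hlim ?_ ?_
  all_goals
    filter_upwards [eventually_ge_atTop 0] with t ht
    have hs : 0 ≤ Real.sinh t := Real.sinh_nonneg_iff.2 ht
    have hc : 0 < Real.cosh t := Real.cosh_pos t
  · positivity
  · have hle : Real.sinh t / (1 + Real.cosh t) ≤ 1 := by
      rw [div_le_one (by positivity)]
      linarith [Real.sinh_lt_cosh t]
    exact (mul_le_of_le_one_right (Real.exp_pos _).le hle).trans
      ((exp_neg_mul_cosh_le_mul_cosh x t).trans (exp_neg_mul_cosh_mul_cosh_le hx t))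

/-- The bound `K₁(x) / K₀(x) ≤ 1 + 1 / (2x)`, from integrating the derivative of
`exp (-x cosh t) * tanh (t / 2)` over the half-line. -/
lemma mul_K1_le {x : ℝ} (hx : 0 < x) : x * K1 x ≤ (x + 1 / 2) * K0 x := by
  have hi0 := integrableOn_exp_neg_mul_cosh hx
  have hi1 := integrableOn_exp_neg_mul_cosh_mul_cosh hx
  have hle (t : ℝ) : 1 / (1 + Real.cosh t) ≤ 1 / 2 :=
    one_div_le_one_div_of_le two_pos (by linarith [Real.one_le_cosh t])
  have hi2 : IntegrableOn (fun t => Real.exp (-x * Real.cosh t) * (1 / (1 + Real.cosh t)))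
      (Ioi 0) := by
    refine (hi0.mul_const (1 / 2)).mono' (Measurable.aestronglyMeasurable (by fun_prop))
      (ae_of_all _ fun t => ?_)
    have hc : 0 < Real.cosh t := Real.cosh_pos t
    rw [Real.norm_of_nonneg (by positivity)]
    exact mul_le_mul_of_nonneg_left (hle t) (Real.exp_pos _).le
  have hi3 : IntegrableOn (fun t => x * (Real.exp (-x * Real.cosh t) * Real.cosh t
      - Real.exp (-x * Real.cosh t))) (Ioi 0) := (hi1.sub hi0).const_mul x
  have hparts := integral_Ioi_of_hasDerivAt_of_tendsto'
    (fun t (_ : t ∈ Ici (0 : ℝ)) => hasDerivAt_exp_neg_mul_cosh_mul_tanh_half x t)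
    (hi2.sub hi3) (tendsto_exp_neg_mul_cosh_mul_tanh_half hx)
  rw [integral_sub hi2 hi3, integral_const_mul,
    integral_sub hi1 hi0] at hparts
  have hhalf : ∫ t in Ioi (0 : ℝ), Real.exp (-x * Real.cosh t) * (1 / (1 + Real.cosh t))
      ≤ K0 x * (1 / 2) := by
    rw [K0, ← integral_mul_const]
    exact integral_mono hi2 (hi0.mul_const _)
      fun t => mul_le_mul_of_nonneg_left (hle t) (Real.exp_pos _).le
  change _ - x * (K1 x - K0 x) = _ at hparts
  simp only [Real.sinh_zero, zero_div, mul_zero, sub_zero] at hparts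
  linarith

theorem eigenvalues_negative (ε : ℝ) (hε : 0 < ε) (k : ℤ) (hk : 1 ≤ |k|) :
    -(1/(8*Real.pi)) * ((4 + Real.pi^2*ε^2*(k:ℝ)^2) * K0 (Real.pi*ε*|(k:ℝ)|)
        - 2*Real.pi*ε*|(k:ℝ)| * K1 (Real.pi*ε*|(k:ℝ)|)) < 0 ∧
    -(1/(8*Real.pi)) * (2 * K0 (Real.pi*ε*|(k:ℝ)|)
        + Real.pi*ε*|(k:ℝ)| * K1 (Real.pi*ε*|(k:ℝ)|)) < 0 := by
  have hk0 : 0 < |(k : ℝ)| := by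
    have : (1 : ℝ) ≤ |(k : ℝ)| := by exact_mod_cast hk
    linarith
  have hx : 0 < Real.pi * ε * |(k : ℝ)| := by positivity
  have hsq : Real.pi ^ 2 * ε ^ 2 * (k : ℝ) ^ 2 = (Real.pi * ε * |(k : ℝ)|) ^ 2 := by
    rw [mul_pow, mul_pow, sq_abs]
  have hassoc : 2 * Real.pi * ε * |(k : ℝ)| = 2 * (Real.pi * ε * |(k : ℝ)|) := by ring
  rw [hsq, hassoc]
  generalize Real.pi * ε * |(k : ℝ)| = x at hx
  have h0 := K0_pos hx
  have h1 : 0 < K1 x := h0.trans_le (K0_le_K1 hx)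
  have hneg : -(1 / (8 * Real.pi)) < 0 := neg_neg_of_pos (by positivity)
  refine ⟨mul_neg_of_neg_of_pos hneg ?_, mul_neg_of_neg_of_pos hneg (by positivity)⟩
  nlinarith [mul_K1_le hx, mul_nonneg (sq_nonneg (x - 1)) h0.le]
end

section
/- For every ε > 0 and every real k ≠ 0, ∫_{−∞}^{∞} (1/(x² + ε²)^{1/2} + x²/(x² + ε²)^{3/2}) · cos(kx) dx = 4·K₀(ε|k|) − 2ε|k|·K₁(ε|k|). (This gives the tangential eigenvalue −(1/8π) times this quantity for the Modified Lighthill 1 slender body operator on a straight periodic fiber.) -/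
open Filter

open MeasureTheory Set

theorem rpow_three_halves_eq {y : ℝ} (hy : 0 ≤ y) : y ^ ((3 : ℝ) / 2) = y * √y := by
  rw [show (3 : ℝ) / 2 = 1 + 1 / 2 by norm_num, Real.rpow_add' hy (by norm_num), Real.rpow_one,
    Real.sqrt_eq_rpow]

theorem integrableOn_sqrt_mul_exp_neg_mul {a : ℝ} (ha : 0 < a) :
    IntegrableOn (fun u : ℝ => √u * Real.exp (-(a * u))) (Ioi 0) := by
  have h := integrableOn_rpow_mul_exp_neg_mul_rpow (s := 1 / 2) (p := 1) (by norm_num)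
    one_pos ha
  simpa [Real.sqrt_eq_rpow] using h

theorem integral_sqrt_mul_exp_neg_mul {a : ℝ} (ha : 0 < a) :
    ∫ u in Ioi (0 : ℝ), √u * Real.exp (-(a * u)) = √Real.pi / 2 / a ^ ((3 : ℝ) / 2) := by
  have h := Real.integral_rpow_mul_exp_neg_mul_Ioi (a := 3 / 2) (r := a) (by norm_num) ha
  have hG : Real.Gamma (3 / 2) = √Real.pi / 2 := by
    rw [show (3 : ℝ) / 2 = 1 / 2 + 1 by norm_num, Real.Gamma_add_one (by norm_num),
      Real.Gamma_one_half_eq]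
    ring
  rw [hG, one_div, Real.inv_rpow ha.le] at h
  rw [div_eq_inv_mul _ (a ^ _), ← h]
  norm_num [Real.sqrt_eq_rpow]

theorem integrable_div_rpow_three_halves {ε M : ℝ} (hε : 0 < ε) {g : ℝ → ℝ} (hg : Continuous g)
    (hM : ∀ x, |g x| ≤ M * √(x ^ 2 + ε ^ 2)) :
    Integrable fun x => g x / (x ^ 2 + ε ^ 2) ^ ((3 : ℝ) / 2) := by
  have hpos (x : ℝ) : 0 < x ^ 2 + ε ^ 2 := by positivity
  have h1 : Integrable fun x : ℝ => M / ε ^ 2 * (1 + (x / ε) ^ 2)⁻¹ :=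
    (integrable_inv_one_add_sq.comp_div hε.ne').const_mul _
  refine h1.mono' (Continuous.aestronglyMeasurable ?_) (.of_forall fun x => ?_)
  · exact hg.div (Continuous.rpow_const (by fun_prop) fun x => .inl (hpos x).ne')
      fun x => (Real.rpow_pos_of_pos (hpos x) _).ne'
  · have hs := Real.sqrt_pos.2 (hpos x)
    rw [rpow_three_halves_eq (hpos x).le, Real.norm_eq_abs, abs_div,
      abs_of_pos (mul_pos (hpos x) hs), div_le_iff₀ (mul_pos (hpos x) hs)]
    refine (hM x).trans_eq ?_
    have h2 : ε ^ 2 + x ^ 2 ≠ 0 := by positivity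
    field_simp
    ring

/-- Writing `(x² + ε²)^(-3/2)` as a mixture of Gaussians. -/
theorem integral_div_rpow_three_halves {ε : ℝ} (hε : 0 < ε) {g : ℝ → ℝ} (hg : Continuous g)
    (hi : Integrable fun x => g x / (x ^ 2 + ε ^ 2) ^ ((3 : ℝ) / 2)) :
    √Real.pi / 2 * ∫ x, g x / (x ^ 2 + ε ^ 2) ^ ((3 : ℝ) / 2) =
      ∫ u in Ioi (0 : ℝ), √u * Real.exp (-(ε ^ 2 * u)) * ∫ x, g x * Real.exp (-u * x ^ 2) := by
  have hpos (x : ℝ) : 0 < x ^ 2 + ε ^ 2 := by positivity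
  let F : ℝ → ℝ → ℝ := fun x u => g x * (√u * Real.exp (-((x ^ 2 + ε ^ 2) * u)))
  have hF : Integrable (Function.uncurry F) (volume.prod (volume.restrict (Ioi 0))) := by
    refine (integrable_prod_iff (Continuous.aestronglyMeasurable ?_)).2 ⟨.of_forall fun x => ?_, ?_⟩
    · simp only [F, Function.uncurry_def]
      fun_prop
    · exact (integrableOn_sqrt_mul_exp_neg_mul (hpos x)).const_mul (g x)
    · refine (hi.norm.const_mul (√Real.pi / 2)).congr (.of_forall fun x => ?_)
      simp only [F, Function.uncurry_apply_pair, norm_mul, Real.norm_eq_abs, Real.abs_exp,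
        abs_of_nonneg (Real.sqrt_nonneg _), abs_div,
        abs_of_pos (Real.rpow_pos_of_pos (hpos x) _)]
      rw [integral_const_mul, integral_sqrt_mul_exp_neg_mul (hpos x)]
      ring
  calc _ = ∫ x, ∫ u in Ioi (0 : ℝ), F x u := by
        rw [← integral_const_mul]
        congr 1 with x
        rw [integral_const_mul, integral_sqrt_mul_exp_neg_mul (hpos x)]
        ring
    _ = ∫ u in Ioi (0 : ℝ), ∫ x, F x u := integral_integral_swap hF
    _ = _ := by
        congr 1 with u
        rw [← integral_const_mul]
        congr 1 with x
        simp only [F]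
        rw [show -((x ^ 2 + ε ^ 2) * u) = -(ε ^ 2 * u) + -u * x ^ 2 by ring, Real.exp_add]
        ring

theorem integral_cos_mul_exp_neg_mul_sq (k : ℝ) {u : ℝ} (hu : 0 < u) :
    ∫ x, Real.cos (k * x) * Real.exp (-u * x ^ 2) =
      √Real.pi / √u * Real.exp (-(k ^ 2 / (4 * u))) := by
  have h := congrArg Complex.re (fourierIntegral_gaussian (b := u) (by simpa using hu) k)
  have hint : Integrable fun x : ℝ =>
      Complex.exp (Complex.I * k * x) * Complex.exp (-u * x ^ 2) := by
    refine (integrable_exp_neg_mul_sq hu).mono' (by fun_prop) (.of_forall fun x => ?_)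
    rw [norm_mul, norm_cexp_neg_mul_sq, mul_assoc, mul_comm Complex.I, ← Complex.ofReal_mul,
      Complex.norm_exp_ofReal_mul_I]
    simp
  rw [← RCLike.re_eq_complex_re, ← integral_re hint] at h
  convert h using 1
  · congr 1 with x
    rw [show (-(u : ℂ) * (x : ℂ) ^ 2) = ((-u * x ^ 2 : ℝ) : ℂ) by push_cast; ring,
      show Complex.I * k * x = ((k * x : ℝ) : ℂ) * Complex.I by push_cast; ring,
      ← Complex.ofReal_exp, RCLike.re_eq_complex_re, Complex.re_mul_ofReal,
      Complex.exp_ofReal_mul_I_re]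
  · rw [show (Real.pi : ℂ) / u = ((Real.pi / u : ℝ) : ℂ) by push_cast; rfl,
      show (1 / 2 : ℂ) = ((1 / 2 : ℝ) : ℂ) by push_cast; rfl,
      ← Complex.ofReal_cpow (by positivity), ← Real.sqrt_eq_rpow,
      show -(k : ℂ) ^ 2 / (4 * u) = ((-(k ^ 2 / (4 * u)) : ℝ) : ℂ) by push_cast; ring,
      ← Complex.ofReal_exp, ← Complex.ofReal_mul, RCLike.re_eq_complex_re, Complex.ofReal_re,
      Real.sqrt_div Real.pi_pos.le]

theorem integral_mul_sin_mul_exp_neg_mul_sq (k : ℝ) {u : ℝ} (hu : 0 < u) :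
    ∫ x, x * Real.sin (k * x) * Real.exp (-u * x ^ 2) =
      k / (2 * u) * (√Real.pi / √u * Real.exp (-(k ^ 2 / (4 * u)))) := by
  have hE := integrable_exp_neg_mul_sq hu
  have hc : Integrable fun x => Real.cos (k * x) * Real.exp (-u * x ^ 2) :=
    hE.bdd_mul (c := 1) (by fun_prop) (.of_forall fun x => Real.abs_cos_le_one _)
  have hs : Integrable fun x => Real.sin (k * x) * Real.exp (-u * x ^ 2) :=
    hE.bdd_mul (c := 1) (by fun_prop) (.of_forall fun x => Real.abs_sin_le_one _)
  have hxs : Integrable fun x => x * Real.sin (k * x) * Real.exp (-u * x ^ 2) := by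
    refine ((integrable_mul_exp_neg_mul_sq hu).bdd_mul (c := 1)
      (f := fun x => Real.sin (k * x)) (by fun_prop)
      (.of_forall fun x => Real.abs_sin_le_one _)).congr (.of_forall fun x => ?_)
    ring
  have hd (x : ℝ) : HasDerivAt (fun x => Real.sin (k * x) * Real.exp (-u * x ^ 2))
      (k * (Real.cos (k * x) * Real.exp (-u * x ^ 2)) -
        2 * u * (x * Real.sin (k * x) * Real.exp (-u * x ^ 2))) x := by
    have h1 := (((hasDerivAt_id x).const_mul k).sin).mul
      (((hasDerivAt_pow 2 x).const_mul (-u)).exp)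
    refine h1.congr_deriv ?_
    simp
    ring
  have h := integral_eq_zero_of_hasDerivAt_of_integrable hd
    ((hc.const_mul k).sub (hxs.const_mul (2 * u))) hs
  rw [integral_sub (hc.const_mul k) (hxs.const_mul (2 * u)), integral_const_mul,
    integral_const_mul, integral_cos_mul_exp_neg_mul_sq k hu] at h
  rw [div_mul_eq_mul_div, eq_div_iff (by positivity)]
  linarith

theorem image_mul_exp_univ {c : ℝ} (hc : 0 < c) : (fun t => c * Real.exp t) '' univ = Ioi 0 := by
  ext y
  simp only [image_univ, mem_range, mem_Ioi]
  refine ⟨?_, fun hy => ⟨Real.log (y / c), ?_⟩⟩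
  · rintro ⟨t, rfl⟩
    positivity
  · rw [Real.exp_log (by positivity)]
    field_simp

theorem hasDerivWithinAt_mul_exp (c : ℝ) : ∀ t ∈ (univ : Set ℝ),
    HasDerivWithinAt (fun t => c * Real.exp t) (c * Real.exp t) univ t := fun t _ =>
  ((Real.hasDerivAt_exp t).const_mul c).hasDerivWithinAt

theorem injOn_mul_exp {c : ℝ} (hc : 0 < c) : InjOn (fun t => c * Real.exp t) univ :=
  fun _ _ _ _ h => Real.exp_injective (mul_left_cancel₀ hc.ne' h)

theorem exponent_comp_mul_exp {ε k : ℝ} (hε : 0 < ε) (hk : 0 < k) (t : ℝ) :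
    -(ε ^ 2 * (k / (2 * ε) * Real.exp t)) + -(k ^ 2 / (4 * (k / (2 * ε) * Real.exp t))) =
      -(ε * k) * Real.cosh t := by
  rw [Real.cosh_eq, Real.exp_neg]
  field_simp
  ring

theorem integral_inv_mul_exp_eq_K0 {ε k : ℝ} (hε : 0 < ε) (hk : 0 < k) :
    ∫ u in Ioi (0 : ℝ), u⁻¹ * Real.exp (-(ε ^ 2 * u) + -(k ^ 2 / (4 * u))) = 2 * K0 (ε * k) := by
  have hc : 0 < k / (2 * ε) := by positivity
  rw [← image_mul_exp_univ hc, integral_image_eq_integral_abs_deriv_smul MeasurableSet.univ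
    (hasDerivWithinAt_mul_exp _) (injOn_mul_exp hc), setIntegral_univ, K0, ← integral_comp_abs]
  congr 1 with t
  have : 0 < k / (2 * ε) * Real.exp t := by positivity
  rw [exponent_comp_mul_exp hε hk, Real.cosh_abs, abs_of_pos this, smul_eq_mul,
    mul_inv_cancel_left₀ this.ne']

theorem integral_exp_eq_K1 {ε k : ℝ} (hε : 0 < ε) (hk : 0 < k) :
    ∫ u in Ioi (0 : ℝ), Real.exp (-(ε ^ 2 * u) + -(k ^ 2 / (4 * u))) = k / ε * K1 (ε * k) := by
  have hc : 0 < k / (2 * ε) := by positivity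
  have hint : IntegrableOn (fun u => Real.exp (-(ε ^ 2 * u) + -(k ^ 2 / (4 * u)))) (Ioi 0) := by
    have h1 : IntegrableOn (fun u : ℝ => Real.exp (-(ε ^ 2) * u)) (Ioi 0) :=
      integrableOn_exp_mul_Ioi (neg_neg_of_pos (by positivity)) 0
    refine h1.mono' (by measurability) ?_
    filter_upwards [ae_restrict_mem measurableSet_Ioi] with u hu
    have hu : 0 < u := hu
    have : 0 ≤ k ^ 2 / (4 * u) := by positivity
    rw [Real.norm_eq_abs, Real.abs_exp, Real.exp_le_exp]
    linarith
  have habs (t : ℝ) : |k / (2 * ε) * Real.exp t| = k / (2 * ε) * Real.exp t :=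
    abs_of_pos (by positivity)
  rw [← image_mul_exp_univ hc] at hint ⊢
  rw [integrableOn_image_iff_integrableOn_abs_deriv_smul MeasurableSet.univ
    (hasDerivWithinAt_mul_exp _) (injOn_mul_exp hc), integrableOn_univ] at hint
  rw [integral_image_eq_integral_abs_deriv_smul MeasurableSet.univ
    (hasDerivWithinAt_mul_exp _) (injOn_mul_exp hc), setIntegral_univ]
  simp only [exponent_comp_mul_exp hε hk, habs, smul_eq_mul] at hint ⊢
  set f : ℝ → ℝ := fun t => k / (2 * ε) * Real.exp t * Real.exp (-(ε * k) * Real.cosh t) with hf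
  have hsum : ∫ t, (f t + f (-t)) = k / ε * (2 * K1 (ε * k)) := by
    rw [K1, ← integral_comp_abs, ← integral_const_mul]
    congr 1 with t
    simp only [hf, Real.cosh_neg, Real.cosh_abs]
    rw [Real.cosh_eq t]
    field_simp
  rw [integral_add hint hint.comp_neg, integral_neg_eq_self] at hsum
  linarith

theorem integral_cos_div_rpow_three_halves {ε k : ℝ} (hε : 0 < ε) (hk : 0 < k)
    (hi : Integrable fun x => Real.cos (k * x) / (x ^ 2 + ε ^ 2) ^ ((3 : ℝ) / 2)) :
    ∫ x, Real.cos (k * x) / (x ^ 2 + ε ^ 2) ^ ((3 : ℝ) / 2) = 2 * (k / ε * K1 (ε * k)) := by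
  have h := integral_div_rpow_three_halves hε (by fun_prop) hi
  have hpi : 0 < √Real.pi := Real.sqrt_pos.2 Real.pi_pos
  refine mul_left_cancel₀ (half_pos hpi).ne' (h.trans ?_)
  rw [← integral_exp_eq_K1 hε hk, ← integral_const_mul, ← integral_const_mul]
  refine setIntegral_congr_fun measurableSet_Ioi fun u hu => ?_
  have hu : 0 < u := hu
  rw [integral_cos_mul_exp_neg_mul_sq k hu, Real.exp_add]
  field_simp

theorem integral_mul_sin_div_rpow_three_halves {ε k : ℝ} (hε : 0 < ε) (hk : 0 < k)
    (hi : Integrable fun x => x * Real.sin (k * x) / (x ^ 2 + ε ^ 2) ^ ((3 : ℝ) / 2)) :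
    ∫ x, x * Real.sin (k * x) / (x ^ 2 + ε ^ 2) ^ ((3 : ℝ) / 2) = k * (2 * K0 (ε * k)) := by
  have h := integral_div_rpow_three_halves hε (by fun_prop) hi
  have hpi : 0 < √Real.pi := Real.sqrt_pos.2 Real.pi_pos
  refine mul_left_cancel₀ (half_pos hpi).ne' (h.trans ?_)
  rw [← integral_inv_mul_exp_eq_K0 hε hk, ← integral_const_mul, ← integral_const_mul]
  refine setIntegral_congr_fun measurableSet_Ioi fun u hu => ?_
  have hu : 0 < u := hu
  rw [integral_mul_sin_mul_exp_neg_mul_sq k hu, Real.exp_add]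
  field_simp

theorem hasDerivAt_sin_div_sqrt {ε k : ℝ} (hε : 0 < ε) (hk : 0 < k) (x : ℝ) :
    HasDerivAt (fun x => 2 / k * (Real.sin (k * x) / √(x ^ 2 + ε ^ 2)))
      ((1 / √(x ^ 2 + ε ^ 2) + x ^ 2 / (x ^ 2 + ε ^ 2) ^ ((3 : ℝ) / 2)) * Real.cos (k * x) -
        (2 / k * (x * Real.sin (k * x) / (x ^ 2 + ε ^ 2) ^ ((3 : ℝ) / 2)) -
          ε ^ 2 * (Real.cos (k * x) / (x ^ 2 + ε ^ 2) ^ ((3 : ℝ) / 2)))) x := by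
  have hpos : 0 < x ^ 2 + ε ^ 2 := by positivity
  have hs := Real.sqrt_pos.2 hpos
  have hss := Real.sq_sqrt hpos.le
  have h := ((((hasDerivAt_id x).const_mul k).sin).div
    (((hasDerivAt_pow 2 x).add_const (ε ^ 2)).sqrt hpos.ne') hs.ne').const_mul (2 / k)
  refine h.congr_deriv ?_
  rw [rpow_three_halves_eq hpos.le]
  simp only [id_eq, Nat.cast_ofNat, Nat.add_one_sub_one, pow_one, mul_one]
  set s := √(x ^ 2 + ε ^ 2)
  rw [← hss]
  field_simp
  rw [show ε ^ 2 = s ^ 2 - x ^ 2 by linarith]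
  ring

theorem tendsto_integral_cos_of_pos {ε k : ℝ} (hε : 0 < ε) (hk : 0 < k) :
    Tendsto (fun R : ℝ => ∫ x in (-R)..R,
        (1 / √(x ^ 2 + ε ^ 2) + x ^ 2 / (x ^ 2 + ε ^ 2) ^ ((3 : ℝ) / 2)) * Real.cos (k * x))
      atTop (nhds (4 * K0 (ε * k) - 2 * ε * k * K1 (ε * k))) := by
  have hpos (x : ℝ) : 0 < x ^ 2 + ε ^ 2 := by positivity
  have hcos : Integrable fun x => Real.cos (k * x) / (x ^ 2 + ε ^ 2) ^ ((3 : ℝ) / 2) := by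
    refine integrable_div_rpow_three_halves (M := 1 / ε) hε (by fun_prop) fun x => ?_
    refine (Real.abs_cos_le_one _).trans ?_
    rw [div_mul_eq_mul_div, one_mul, one_le_div hε]
    exact Real.le_sqrt_of_sq_le (by nlinarith [sq_nonneg x])
  have hsin : Integrable fun x => x * Real.sin (k * x) / (x ^ 2 + ε ^ 2) ^ ((3 : ℝ) / 2) := by
    refine integrable_div_rpow_three_halves (M := 1) hε (by fun_prop) fun x => ?_
    rw [abs_mul, one_mul]
    refine (mul_le_of_le_one_right (abs_nonneg x) (Real.abs_sin_le_one _)).trans ?_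
    exact Real.abs_le_sqrt (by nlinarith [sq_nonneg ε])
  have hrem : Integrable fun x =>
      2 / k * (x * Real.sin (k * x) / (x ^ 2 + ε ^ 2) ^ ((3 : ℝ) / 2)) -
        ε ^ 2 * (Real.cos (k * x) / (x ^ 2 + ε ^ 2) ^ ((3 : ℝ) / 2)) :=
    (hsin.const_mul (2 / k)).sub (hcos.const_mul (ε ^ 2))
  have hcont : Continuous fun x : ℝ =>
      (1 / √(x ^ 2 + ε ^ 2) + x ^ 2 / (x ^ 2 + ε ^ 2) ^ ((3 : ℝ) / 2)) * Real.cos (k * x) := by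
    have h1 : Continuous fun x : ℝ => (x ^ 2 + ε ^ 2) ^ ((3 : ℝ) / 2) :=
      Continuous.rpow_const (by fun_prop) fun x => .inl (hpos x).ne'
    exact ((continuous_const.div (by fun_prop) fun x => (Real.sqrt_pos.2 (hpos x)).ne').add
      ((continuous_pow 2).div h1 fun x => (Real.rpow_pos_of_pos (hpos x) _).ne')).mul
      (by fun_prop)
  have hlim := intervalIntegral_tendsto_integral hrem tendsto_neg_atTop_atBot tendsto_id
  rw [integral_sub (hsin.const_mul _) (hcos.const_mul _), integral_const_mul, integral_const_mul,
    integral_cos_div_rpow_three_halves hε hk hcos,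
    integral_mul_sin_div_rpow_three_halves hε hk hsin] at hlim
  have hbdry : Tendsto (fun R : ℝ => 2 * (2 / k * (Real.sin (k * R) / √(R ^ 2 + ε ^ 2))))
      atTop (nhds 0) := by
    have h : Tendsto (fun R : ℝ => Real.sin (k * R) / √(R ^ 2 + ε ^ 2)) atTop (nhds 0) := by
      refine squeeze_zero_norm' ?_ tendsto_inv_atTop_zero
      filter_upwards [eventually_gt_atTop 0] with R hR
      rw [norm_div, Real.norm_eq_abs, Real.norm_eq_abs, abs_of_nonneg (Real.sqrt_nonneg _),
        inv_eq_one_div]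
      exact div_le_div₀ zero_le_one (Real.abs_sin_le_one _) hR
        (Real.le_sqrt_of_sq_le (by nlinarith [sq_nonneg ε]))
    simpa using (h.const_mul (2 / k)).const_mul 2
  convert hbdry.add hlim using 1
  · ext R
    have hI := hrem.intervalIntegrable (a := -R) (b := R)
    have h := intervalIntegral.integral_eq_sub_of_hasDerivAt
      (fun x _ => hasDerivAt_sin_div_sqrt hε hk x)
      ((hcont.intervalIntegrable (-R) R).sub hI)
    rw [intervalIntegral.integral_sub (hcont.intervalIntegrable (-R) R) hI] at h
    rw [sub_eq_iff_eq_add.1 h, mul_neg, Real.sin_neg, neg_sq, id]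
    ring
  · congr 1
    field_simp
    ring

/-- Tangential eigenvalue integral for the Modified Lighthill 1 slender body operator,
as a principal value over the real line. -/
theorem modified_lighthill_integral (ε k : ℝ) (hε : 0 < ε) (hk : k ≠ 0) :
    Tendsto (fun R : ℝ => ∫ x in (-R)..R,
        (1 / Real.sqrt (x^2 + ε^2) + x^2 / (x^2 + ε^2)^((3:ℝ)/2)) * Real.cos (k*x))
      atTop (nhds (4 * K0 (ε * |k|) - 2*ε*|k| * K1 (ε * |k|))) := by
  have h := tendsto_integral_cos_of_pos hε (abs_pos.2 hk)
  have hcos (x : ℝ) : Real.cos (|k| * x) = Real.cos (k * x) := by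
    rcases abs_choice k with h | h <;> simp [h]
  simpa only [hcos] using h
end
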